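/- In the maximally entangled case θ=π/2, the pure-strategy quantum prisoner's dilemma has no Nash equilibrium: there is no pair (x_A*,x_B*)∈S³×S³ such that $_A(x_A,x_B*) ≤ $_A(x_A*,x_B*) for all x_A∈S³ and $_B(x_A*,x_B) ≤ $_B(x_A*,x_B*) for all x_B∈S³. -/

import Mathlib

open Matrix Kronecker

noncomputable section

/-- Pauli X matrix. -/
def pauliX : Matrix (Fin 2) (Fin 2) ℂ := !![0, 1; 1, 0]
/-- Pauli Y matrix. -/
def pauliY : Matrix (Fin 2) (Fin 2) ℂ := !![0, -Complex.I; Complex.I, 0]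
/-- Pauli Z matrix. -/
def pauliZ : Matrix (Fin 2) (Fin 2) ℂ := !![1, 0; 0, -1]

/-- The entangling operator J = cos(θ/2)·I₄ + i sin(θ/2)·(Y⊗Y). -/
def Jmat (θ : ℝ) : Matrix (Fin 2 × Fin 2) (Fin 2 × Fin 2) ℂ :=
  (Real.cos (θ / 2) : ℂ) • 1 + (Complex.I * Real.sin (θ / 2)) • (pauliY ⊗ₖ pauliY)

/-- The strategy unitary U(x) = α·I + i(β·X + γ·Y + δ·Z) encoded by x = (α,β,γ,δ). -/
def Umat (x : Fin 4 → ℝ) : Matrix (Fin 2) (Fin 2) ℂ :=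
  (x 0 : ℂ) • 1 + Complex.I •
    ((x 1 : ℂ) • pauliX + (x 2 : ℂ) • pauliY + (x 3 : ℂ) • pauliZ)

/-- The initial state |CC⟩. -/
def ketCC : Fin 2 × Fin 2 → ℂ := fun i => if i = (0, 0) then 1 else 0

/-- The final state |ψ⟩ = J†(U(x_A)⊗U(x_B))J|CC⟩. -/
def gameState (θ : ℝ) (xA xB : Fin 4 → ℝ) : Fin 2 × Fin 2 → ℂ :=
  ((Jmat θ)ᴴ * (Umat xA ⊗ₖ Umat xB) * Jmat θ).mulVec ketCC

/-- Alice's payoff: r|⟨CC|ψ⟩|² + s|⟨CD|ψ⟩|² + t|⟨DC|ψ⟩|² + p|⟨DD|ψ⟩|². -/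
def payoffA (t r p s θ : ℝ) (xA xB : Fin 4 → ℝ) : ℝ :=
  r * Complex.normSq (gameState θ xA xB (0, 0))
  + s * Complex.normSq (gameState θ xA xB (0, 1))
  + t * Complex.normSq (gameState θ xA xB (1, 0))
  + p * Complex.normSq (gameState θ xA xB (1, 1))

/-- Bob's payoff: r|⟨CC|ψ⟩|² + t|⟨CD|ψ⟩|² + s|⟨DC|ψ⟩|² + p|⟨DD|ψ⟩|². -/
def payoffB (t r p s θ : ℝ) (xA xB : Fin 4 → ℝ) : ℝ :=
  r * Complex.normSq (gameState θ xA xB (0, 0))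
  + t * Complex.normSq (gameState θ xA xB (0, 1))
  + s * Complex.normSq (gameState θ xA xB (1, 0))
  + p * Complex.normSq (gameState θ xA xB (1, 1))

/-- A pure strategy lies on the unit sphere S³ ⊂ ℝ⁴. -/
def onSphere (x : Fin 4 → ℝ) : Prop :=
  x 0 ^ 2 + x 1 ^ 2 + x 2 ^ 2 + x 3 ^ 2 = 1

/-- Nash equilibrium for the pure-strategy quantum game. -/
def PureNashEq (t r p s θ : ℝ) (xA xB : Fin 4 → ℝ) : Prop :=
  (∀ y, onSphere y → payoffA t r p s θ y xB ≤ payoffA t r p s θ xA xB) ∧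
  (∀ y, onSphere y → payoffB t r p s θ xA y ≤ payoffB t r p s θ xA xB)


/-- At `θ = π/2` the amplitudes of the game state are real bilinear forms in the strategies. -/
lemma gameState_pi_div_two (x y : Fin 4 → ℝ) :
    gameState (Real.pi / 2) x y (0, 0) = ((x 0 * y 0 - x 3 * y 3 + x 1 * y 2 + x 2 * y 1 : ℝ) : ℂ) ∧
    gameState (Real.pi / 2) x y (0, 1) = ((x 1 * y 0 - x 2 * y 3 - x 0 * y 2 - x 3 * y 1 : ℝ) : ℂ) ∧
    gameState (Real.pi / 2) x y (1, 0) = ((x 0 * y 1 - x 3 * y 2 - x 2 * y 0 - x 1 * y 3 : ℝ) : ℂ) ∧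
    gameState (Real.pi / 2) x y (1, 1) =
      ((x 2 * y 2 - x 1 * y 1 - x 0 * y 3 - x 3 * y 0 : ℝ) : ℂ) := by
  have h2 : Real.sqrt 2 ^ 2 = 2 := Real.sq_sqrt (by norm_num)
  have hθ : Real.pi / 2 / 2 = Real.pi / 4 := by ring
  refine ⟨?_, ?_, ?_, ?_⟩ <;>
  · simp only [gameState, Jmat, Umat, pauliX, pauliY, pauliZ, ketCC, hθ, Real.cos_pi_div_four,
      Real.sin_pi_div_four, Matrix.mulVec, dotProduct, Matrix.mul_apply, Fintype.sum_prod_type,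
      Fin.sum_univ_two, Matrix.conjTranspose_apply, Matrix.add_apply, Matrix.smul_apply,
      Matrix.kroneckerMap_apply, Matrix.one_apply]
    simp [Complex.ext_iff]
    constructor <;> ring_nf <;> simp only [h2] <;> ring

lemma payoffA_pi_div_two (t r p s : ℝ) (x y : Fin 4 → ℝ) :
    payoffA t r p s (Real.pi / 2) x y =
      r * (x 0 * y 0 - x 3 * y 3 + x 1 * y 2 + x 2 * y 1) ^ 2
      + s * (x 1 * y 0 - x 2 * y 3 - x 0 * y 2 - x 3 * y 1) ^ 2
      + t * (x 0 * y 1 - x 3 * y 2 - x 2 * y 0 - x 1 * y 3) ^ 2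
      + p * (x 2 * y 2 - x 1 * y 1 - x 0 * y 3 - x 3 * y 0) ^ 2 := by
  obtain ⟨h₀, h₁, h₂, h₃⟩ := gameState_pi_div_two x y
  simp only [payoffA, h₀, h₁, h₂, h₃, Complex.normSq_ofReal, sq]

lemma payoffB_eq_payoffA (t r p s θ : ℝ) (x y : Fin 4 → ℝ) :
    payoffB t r p s θ x y = payoffA s r p t θ x y := rfl

/-- Against any strategy, Alice can force the outcome `DC`. -/
lemma exists_payoffA_eq (t r p s : ℝ) {y : Fin 4 → ℝ} (hy : onSphere y) :
    ∃ x, onSphere x ∧ payoffA t r p s (Real.pi / 2) x y = t := by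
  unfold onSphere at hy
  refine ⟨![y 1, -y 3, -y 0, -y 2], ?_, ?_⟩
  · simp [onSphere]
    linarith
  · rw [payoffA_pi_div_two]
    simp
    linear_combination t * (y 0 ^ 2 + y 1 ^ 2 + y 2 ^ 2 + y 3 ^ 2 + 1) * hy

/-- Against any strategy, Bob can force the outcome `CD`. -/
lemma exists_payoffB_eq (t r p s : ℝ) {x : Fin 4 → ℝ} (hx : onSphere x) :
    ∃ y, onSphere y ∧ payoffB t r p s (Real.pi / 2) x y = t := by
  unfold onSphere at hx
  refine ⟨![x 1, -x 3, -x 0, -x 2], ?_, ?_⟩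
  · simp [onSphere]
    linarith
  · rw [payoffB_eq_payoffA, payoffA_pi_div_two]
    simp
    linear_combination t * (x 0 ^ 2 + x 1 ^ 2 + x 2 ^ 2 + x 3 ^ 2 + 1) * hx

/-- The total payoff is less than twice the temptation payoff. -/
lemma payoffA_add_payoffB_lt {t r p s : ℝ} (ht : r < t) (hr : p < r) (hp : s < p)
    {x y : Fin 4 → ℝ} (hx : onSphere x) (hy : onSphere y) :
    payoffA t r p s (Real.pi / 2) x y + payoffB t r p s (Real.pi / 2) x y < 2 * t := by
  unfold onSphere at hx hy
  rw [payoffB_eq_payoffA, payoffA_pi_div_two, payoffA_pi_div_two]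
  have hsum : (x 0 * y 0 - x 3 * y 3 + x 1 * y 2 + x 2 * y 1) ^ 2
      + (x 1 * y 0 - x 2 * y 3 - x 0 * y 2 - x 3 * y 1) ^ 2
      + (x 0 * y 1 - x 3 * y 2 - x 2 * y 0 - x 1 * y 3) ^ 2
      + (x 2 * y 2 - x 1 * y 1 - x 0 * y 3 - x 3 * y 0) ^ 2 = 1 := by
    linear_combination (y 0 ^ 2 + y 1 ^ 2 + y 2 ^ 2 + y 3 ^ 2) * hx + hy
  have h₀ := sq_nonneg (x 0 * y 0 - x 3 * y 3 + x 1 * y 2 + x 2 * y 1)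
  have h₁ := sq_nonneg (x 1 * y 0 - x 2 * y 3 - x 0 * y 2 - x 3 * y 1)
  have h₂ := sq_nonneg (x 0 * y 1 - x 3 * y 2 - x 2 * y 0 - x 1 * y 3)
  have h₃ := sq_nonneg (x 2 * y 2 - x 1 * y 1 - x 0 * y 3 - x 3 * y 0)
  generalize (x 0 * y 0 - x 3 * y 3 + x 1 * y 2 + x 2 * y 1) ^ 2 = a at *
  generalize (x 1 * y 0 - x 2 * y 3 - x 0 * y 2 - x 3 * y 1) ^ 2 = b at *
  generalize (x 0 * y 1 - x 3 * y 2 - x 2 * y 0 - x 1 * y 3) ^ 2 = c at *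
  generalize (x 2 * y 2 - x 1 * y 1 - x 0 * y 3 - x 3 * y 0) ^ 2 = d at *
  obtain ⟨m, hmr, hms, hmt⟩ : ∃ m, 2 * r ≤ m ∧ s + t ≤ m ∧ m < 2 * t :=
    ⟨max (2 * r) (s + t), le_max_left _ _, le_max_right _ _, max_lt (by linarith) (by linarith)⟩
  have ha := mul_le_mul_of_nonneg_right hmr h₀
  have hb := mul_le_mul_of_nonneg_right hms h₁
  have hc := mul_le_mul_of_nonneg_right hms h₂
  have hd := mul_le_mul_of_nonneg_right (show 2 * p ≤ m by linarith) h₃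
  have hm : m * a + m * b + m * c + m * d = m := by linear_combination m * hsum
  linarith

/-- in the maximally entangled case θ = π/2, the pure-strategy quantum
prisoner's dilemma has no Nash equilibrium. -/
theorem stmt_3 (t r p s : ℝ) (ht : t > r) (hr : r > p) (hp : p > s) (hs : s ≥ 0) :
    ¬ ∃ xA xB : Fin 4 → ℝ, onSphere xA ∧ onSphere xB ∧
      PureNashEq t r p s (Real.pi / 2) xA xB := by
  rintro ⟨x, y, hx, hy, hA, hB⟩
  obtain ⟨x', hx', hA'⟩ := exists_payoffA_eq t r p s hy
  obtain ⟨y', hy', hB'⟩ := exists_payoffB_eq t r p s hx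
  linarith [hA x' hx', hB y' hy', payoffA_add_payoffB_lt ht hr hp hx hy]
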